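/- arXiv:1109.6789 — 2 statements merged into one kernel-verified Lean document; each statement's English description precedes it below -/
import Mathlib

section
/- Let Σ₃ = {[[x,0],[0,0]] : x ∈ ℝ}, Σ₃⊥ = {[[0,v],[v,u]] : u,v ∈ ℝ}, K_∞(σ₃) = {[[e^t,0],[s,e^t]] : s,t ∈ ℝ}, and H_{−1/2,0}(σ₃) = {[[e^{−t/2},0],[0,e^{t/2}]] : t ∈ ℝ}. Then the subgroups Σ₃⋊K_∞(σ₃) and Σ₃⊥⋊H_{−1/2,0}(σ₃) of Sp(2,ℝ) are conjugate: there exists g ∈ Sp(2,ℝ) with g·(Σ₃⋊K_∞(σ₃))·g⁻¹ = Σ₃⊥⋊H_{−1/2,0}(σ₃). -/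
open Matrix

noncomputable section

abbrev M2 := Matrix (Fin 2) (Fin 2) ℝ
abbrev M4 := Matrix (Fin 2 ⊕ Fin 2) (Fin 2 ⊕ Fin 2) ℝ

/-- The standard symplectic form `J = [[0, I₂], [-I₂, 0]]`. -/
def Jmat : M4 := fromBlocks 0 1 (-1) 0

/-- The symplectic group `Sp(2, ℝ)` as a set of `4 × 4` matrices. -/
def SpSet : Set M4 := {g | gᵀ * Jmat * g = Jmat}

/-- The block matrix `g(σ, h) = [[h, 0], [σh, ᵀh⁻¹]]`. -/
def gmat (σ h : M2) : M4 := fromBlocks h 0 (σ * h) h⁻¹ᵀ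

/-- The semidirect product set `Σ ⋊ H = {g(σ, h) : σ ∈ Σ, h ∈ H}`. -/
def sdp (S H : Set M2) : Set M4 := {g | ∃ σ ∈ S, ∃ h ∈ H, g = gmat σ h}

/-- Conjugation of a set of `4 × 4` matrices: `g·S·g⁻¹`. -/
def conj4 (g : M4) (S : Set M4) : Set M4 := (fun x => g * x * g⁻¹) '' S

/-- `Σ₃ = {[[x,0],[0,0]] : x ∈ ℝ}`. -/
def Sigma3 : Set M2 := {m | ∃ x : ℝ, m = !![x, 0; 0, 0]}

/-- `Σ₃⊥ = {[[0,v],[v,u]] : u, v ∈ ℝ}`. -/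
def Sigma3perp : Set M2 := {m | ∃ u v : ℝ, m = !![0, v; v, u]}

/-- `K_∞(σ₃) = {[[e^t,0],[s,e^t]] : s, t ∈ ℝ}`. -/
def Kinf : Set M2 := {m | ∃ s t : ℝ, m = !![Real.exp t, 0; s, Real.exp t]}

/-- `H_{−1/2,0}(σ₃) = {[[e^{−t/2},0],[0,e^{t/2}]] : t ∈ ℝ}`. -/
def Hhalf : Set M2 := {m | ∃ t : ℝ, m = !![Real.exp (-t / 2), 0; 0, Real.exp (t / 2)]}

def gc : M4 := fromBlocks !![0,0;1,0] !![0,1;0,0] !![0,-1;0,0] !![0,0;1,0]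

def gci : M4 := fromBlocks !![0,1;0,0] !![0,0;-1,0] !![0,0;1,0] !![0,1;0,0]

lemma gc_mul : gc * gci = 1 := by
  unfold gc gci
  rw [fromBlocks_multiply, ← fromBlocks_one]
  congr 1 <;> ext i j <;> fin_cases i <;> fin_cases j <;> simp

lemma inv_low (a s : ℝ) (ha : a ≠ 0) :
    (!![a, 0; s, a] : M2)⁻¹ = !![a⁻¹, 0; -s * a⁻¹ * a⁻¹, a⁻¹] := by
  apply Matrix.inv_eq_right_inv
  ext i j
  fin_cases i <;> fin_cases j <;> simp [ha] <;> field_simp <;> simp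

lemma inv_dia (a : ℝ) (ha : a ≠ 0) :
    (!![a⁻¹, 0; 0, a] : M2)⁻¹ = !![a, 0; 0, a⁻¹] := by
  apply Matrix.inv_eq_right_inv
  ext i j
  fin_cases i <;> fin_cases j <;> simp [ha]

lemma key (a s x : ℝ) (ha : a ≠ 0) :
    gc * gmat !![x, 0; 0, 0] !![a, 0; s, a] * gc⁻¹
      = gmat !![0, -s * a⁻¹; -s * a⁻¹, x] !![a⁻¹, 0; 0, a] := by
  rw [Matrix.inv_eq_right_inv gc_mul]
  unfold gmat gc gci
  rw [inv_low a s ha, inv_dia a ha, fromBlocks_multiply, fromBlocks_multiply]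
  congr 1 <;> ext i j <;> fin_cases i <;> fin_cases j <;>
    simp [Matrix.mul_apply, Matrix.vecMul, dotProduct, Fin.sum_univ_two, ha]

theorem stmt17 : ∃ g ∈ SpSet, conj4 g (sdp Sigma3 Kinf) = sdp Sigma3perp Hhalf := by
  refine ⟨gc, ?_, ?_⟩
  · unfold SpSet gc Jmat
    rw [Set.mem_setOf_eq, fromBlocks_transpose, fromBlocks_multiply, fromBlocks_multiply]
    congr 1 <;> ext i j <;> fin_cases i <;> fin_cases j <;>
      simp [Matrix.mul_apply, Fin.sum_univ_two]
  · ext m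
    constructor
    · rintro ⟨_, ⟨_, ⟨x, rfl⟩, _, ⟨s, t, rfl⟩, rfl⟩, rfl⟩
      refine ⟨_, ⟨x, -s * (Real.exp t)⁻¹, rfl⟩, _, ⟨2 * t, rfl⟩, ?_⟩
      have h1 : Real.exp (-(2 * t) / 2) = (Real.exp t)⁻¹ := by
        rw [← Real.exp_neg]; congr 1; ring
      have h2 : Real.exp (2 * t / 2) = Real.exp t := by congr 1; ring
      rw [h1, h2]
      exact key _ s x (Real.exp_ne_zero t)
    · rintro ⟨_, ⟨u, v, rfl⟩, _, ⟨t, rfl⟩, rfl⟩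
      refine ⟨_, ⟨_, ⟨u, rfl⟩, _, ⟨-v * Real.exp (t / 2), t / 2, rfl⟩, rfl⟩, ?_⟩
      have h1 : Real.exp (-t / 2) = (Real.exp (t / 2))⁻¹ := by
        rw [← Real.exp_neg]; congr 1; ring
      have h2 : -(-v * Real.exp (t / 2)) * (Real.exp (t / 2))⁻¹ = v := by
        field_simp; try simp
      have h := key (Real.exp (t / 2)) (-v * Real.exp (t / 2)) u (Real.exp_ne_zero _)
      rw [h2] at h
      rw [h1]
      exact h
end
end

section
/- Let Σ₃⊥ = {[[0,v],[v,u]] : u,v ∈ ℝ}, and for γ ∈ ℝ let ᵗL_γ(σ₃) = {[[e^{γt},s],[0,e^{(γ+1)t}]] : s,t ∈ ℝ} and ᵗK_∞(σ₃) = {[[e^t,s],[0,e^t]] : s,t ∈ ℝ}. Then: (a) there exists g ∈ Sp(2,ℝ) with g·(Σ₃⊥⋊ᵗK_∞(σ₃))·g⁻¹ = Σ₃⊥⋊ᵗL_{−1/2}(σ₃); (b) for every γ ≠ −1/2 there exists g ∈ Sp(2,ℝ) with g·(Σ₃⊥⋊ᵗL_γ(σ₃))·g⁻¹ = Σ₃⊥⋊ᵗL_{−γ/(2γ+1)}(σ₃).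 -/
open Matrix

noncomputable section

/-- `ᵗL_γ(σ₃) = {[[e^{γt},s],[0,e^{(γ+1)t}]] : s, t ∈ ℝ}`. -/
def tLgam (γ : ℝ) : Set M2 :=
  {m | ∃ s t : ℝ, m = !![Real.exp (γ * t), s; 0, Real.exp ((γ + 1) * t)]}

/-- `ᵗK_∞(σ₃) = {[[e^t,s],[0,e^t]] : s, t ∈ ℝ}`. -/
def tKinf : Set M2 := {m | ∃ s t : ℝ, m = !![Real.exp t, s; 0, Real.exp t]}

/-- Weyl element. -/
def wG : M4 := fromBlocks !![0, 0; 0, 1] !![1, 0; 0, 0] !![-1, 0; 0, 0] !![0, 0; 0, 1]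

/-- Its inverse. -/
def wGi : M4 := fromBlocks !![0, 0; 0, 1] !![-1, 0; 0, 0] !![1, 0; 0, 0] !![0, 0; 0, 1]

lemma wG_mul : wG * wGi = 1 := by
  rw [wG, wGi, fromBlocks_multiply, ← fromBlocks_one]
  congr 1 <;> ext i j <;> fin_cases i <;> fin_cases j <;>
    simp [Matrix.mul_apply, Fin.sum_univ_two]

lemma wG_inv : wG⁻¹ = wGi := Matrix.inv_eq_right_inv wG_mul

lemma wG_mem : wG ∈ SpSet := by
  show wGᵀ * Jmat * wG = Jmat
  rw [wG, Jmat, fromBlocks_transpose, fromBlocks_multiply, fromBlocks_multiply]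
  congr 1 <;> ext i j <;> fin_cases i <;> fin_cases j <;>
    simp [Matrix.mul_apply, Fin.sum_univ_two]

/-- Upper triangular matrices with given diagonal. -/
def TD (a b : ℝ → ℝ) : Set M2 := {m | ∃ s t : ℝ, m = !![a t, s; 0, b t]}

lemma tri_inv (a b s : ℝ) (ha : a ≠ 0) (hb : b ≠ 0) :
    (!![a, s; 0, b] : M2)⁻¹ = !![a⁻¹, -s / (a * b); 0, b⁻¹] := by
  apply Matrix.inv_eq_right_inv
  ext i j
  fin_cases i <;> fin_cases j <;> simp [ha, hb]
  field_simp
  ring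

lemma tri_invT (a b s : ℝ) (ha : a ≠ 0) (hb : b ≠ 0) :
    (!![a, s; 0, b] : M2)⁻¹ᵀ = !![a⁻¹, 0; -s / (a * b), b⁻¹] := by
  rw [tri_inv a b s ha hb]
  ext i j
  fin_cases i <;> fin_cases j <;> rfl

lemma key_s19 (a b s u v : ℝ) (ha : a ≠ 0) (hb : b ≠ 0) :
    wG * gmat !![0, v; v, u] !![a, s; 0, b] * wG⁻¹ =
      gmat !![0, -s / b; -s / b, u + 2 * v * s / b] !![a⁻¹, v * b; 0, b] := by
  rw [wG_inv, gmat, gmat, tri_invT a b s ha hb, tri_invT _ b _ (inv_ne_zero ha) hb, wG, wGi,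
    fromBlocks_multiply, fromBlocks_multiply]
  congr 1 <;> ext i j <;> fin_cases i <;> fin_cases j <;>
    simp [Matrix.mul_apply, Fin.sum_univ_two] <;> field_simp
  all_goals ring

lemma conj_TD (a b a' b' : ℝ → ℝ) (ha : ∀ t, a t ≠ 0) (hb : ∀ t, b t ≠ 0)
    (h1 : ∀ t, ∃ t', (a t)⁻¹ = a' t' ∧ b t = b' t')
    (h2 : ∀ t', ∃ t, (a t)⁻¹ = a' t' ∧ b t = b' t') :
    conj4 wG (sdp Sigma3perp (TD a b)) = sdp Sigma3perp (TD a' b') := by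
  ext x
  constructor
  · rintro ⟨_, ⟨_, ⟨u, v, rfl⟩, _, ⟨s, t, rfl⟩, rfl⟩, rfl⟩
    obtain ⟨t', e1, e2⟩ := h1 t
    refine ⟨_, ⟨u + 2 * v * s / b t, -s / b t, rfl⟩, _, ⟨v * b t, t', rfl⟩, ?_⟩
    rw [← e1, ← e2]
    exact key_s19 _ _ _ _ _ (ha t) (hb t)
  · rintro ⟨_, ⟨u, v, rfl⟩, _, ⟨s, t', rfl⟩, rfl⟩
    obtain ⟨t, e1, e2⟩ := h2 t'
    refine ⟨_, ⟨_, ⟨u + 2 * v * s / b t, s / b t, rfl⟩, _, ⟨-v * b t, t, rfl⟩, rfl⟩, ?_⟩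
    have hbt := hb t
    show wG * _ * wG⁻¹ = _
    rw [key_s19 _ _ _ _ _ (ha t) hbt, ← e1, ← e2]
    have e3 : -(-v * b t) / b t = v := by field_simp
    have e4 : u + 2 * v * s / b t + 2 * (s / b t) * (-v * b t) / b t = u := by
      field_simp
      ring
    have e5 : s / b t * b t = s := by field_simp
    rw [e3, e4, e5]

theorem stmt19 :
    -- (a)
    (∃ g ∈ SpSet, conj4 g (sdp Sigma3perp tKinf) = sdp Sigma3perp (tLgam (-1/2))) ∧
    -- (b)
    (∀ γ : ℝ, γ ≠ -1/2 → ∃ g ∈ SpSet,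
      conj4 g (sdp Sigma3perp (tLgam γ)) = sdp Sigma3perp (tLgam (-γ / (2 * γ + 1)))) := by
  refine ⟨⟨wG, wG_mem, ?_⟩, fun γ hγ => ⟨wG, wG_mem, ?_⟩⟩
  · have h1 : tKinf = TD (fun t => Real.exp t) (fun t => Real.exp t) := rfl
    have h2 : tLgam (-1/2) = TD (fun t => Real.exp ((-1/2) * t))
      (fun t => Real.exp ((-1/2 + 1) * t)) := rfl
    rw [h1, h2]
    refine conj_TD _ _ _ _ (fun t => (Real.exp_pos t).ne') (fun t => (Real.exp_pos t).ne')
      (fun t => ⟨2 * t, ?_, ?_⟩) (fun t => ⟨t / 2, ?_, ?_⟩)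
    all_goals beta_reduce
    all_goals try rw [← Real.exp_neg]
    all_goals congr 1
    all_goals ring
  · have h1 : ∀ γ, tLgam γ = TD (fun t => Real.exp (γ * t))
      (fun t => Real.exp ((γ + 1) * t)) := fun _ => rfl
    have h0 : 2 * γ + 1 ≠ 0 := fun h => hγ (by linarith)
    rw [h1, h1]
    refine conj_TD _ _ _ _ (fun t => (Real.exp_pos _).ne') (fun t => (Real.exp_pos _).ne')
      (fun t => ⟨(2 * γ + 1) * t, ?_, ?_⟩) (fun t => ⟨t / (2 * γ + 1), ?_, ?_⟩)
    all_goals beta_reduce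
    all_goals try rw [← Real.exp_neg]
    all_goals congr 1
    all_goals
      obtain ⟨c, hc⟩ : ∃ c, c = 2 * γ + 1 := ⟨_, rfl⟩
      have hg : γ = (c - 1) / 2 := by linarith
      rw [← hc] at h0 ⊢
      subst hg
      field_simp
      try ring
end
end
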